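/- Let Q_x and Q_y be the partial derivatives of q(x,y) = (x+1)(y+1)(x+y+1) − rxy, let R₁ = Res_y(Q_x, q) and R₂ = Res_y(Q_y, q) be resultants with respect to y. Then (x+1) divides both R₁ and R₂, and Res_x(R₁/(x+1), R₂/(x+1)) = −r⁸(r² − 11r − 1)². -/

import Mathlib

/-- The resultant of two polynomials `p`, `q` of degrees (at most) `m`, `n`,
as the determinant of the `(m+n) × (m+n)` Sylvester matrix. -/
noncomputable def res {R : Type*} [CommRing R] (m n : ℕ) (p q : Polynomial R) : R :=
  Matrix.det (Matrix.of fun i j : Fin (m + n) =>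
    if (i : ℕ) < n then
      (if (i : ℕ) ≤ (j : ℕ) ∧ (j : ℕ) ≤ m + (i : ℕ) then p.coeff (m + (i : ℕ) - (j : ℕ)) else 0)
    else
      (if (i : ℕ) - n ≤ (j : ℕ) ∧ (j : ℕ) ≤ n + ((i : ℕ) - n) then
        q.coeff (n + ((i : ℕ) - n) - (j : ℕ)) else 0))

/-- Coefficient ring `ℝ[r][x]`. -/
noncomputable abbrev A : Type := Polynomial (Polynomial ℝ)

/-- The parameter `r` as an element of `A = ℝ[r][x]`. -/
noncomputable def rA : A := Polynomial.C Polynomial.X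

/-- The variable `x` as an element of `A`. -/
noncomputable def xA : A := Polynomial.X

/-- `q(x,y) = (x+1)(y+1)(x+y+1) - rxy`, as a polynomial in `y` over `A`. -/
noncomputable def qxy : Polynomial A :=
  Polynomial.C (xA + 1) * (Polynomial.X + 1) * (Polynomial.X + Polynomial.C (xA + 1)) -
    Polynomial.C (rA * xA) * Polynomial.X

/-- Partial derivative in `x` of a polynomial in `y` over `A = ℝ[r][x]`. -/
noncomputable def pderivX (p : Polynomial A) : Polynomial A :=
  p.sum fun n c => Polynomial.C (Polynomial.derivative c) * Polynomial.X ^ n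

theorem pderivX_add (p q : Polynomial A) : pderivX (p + q) = pderivX p + pderivX q := by
  unfold pderivX
  apply Polynomial.sum_add_index <;> simp [add_mul]

theorem pderivX_monomial (n : ℕ) (c : A) :
    pderivX (Polynomial.monomial n c) = Polynomial.monomial n (Polynomial.derivative c) := by
  unfold pderivX
  rw [Polynomial.sum_monomial_index _ _ (by simp), Polynomial.C_mul_X_pow_eq_monomial]

theorem qxy_eq : qxy = Polynomial.monomial 2 (xA + 1)
    + Polynomial.monomial 1 ((xA + 1) * (xA + 2) - rA * xA)
    + Polynomial.monomial 0 ((xA + 1) ^ 2) := by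
  simp only [← Polynomial.C_mul_X_pow_eq_monomial, qxy]
  simp only [map_add, map_sub, map_mul, map_pow, map_one, map_ofNat]
  ring

theorem pderivX_qxy : pderivX qxy = Polynomial.monomial 2 1
    + Polynomial.monomial 1 (2 * xA + 3 - rA)
    + Polynomial.monomial 0 (2 * xA + 2) := by
  rw [qxy_eq, pderivX_add, pderivX_add, pderivX_monomial, pderivX_monomial, pderivX_monomial]
  have h1 : Polynomial.derivative (xA + 1) = 1 := by simp [xA]
  have h2 : Polynomial.derivative ((xA + 1) * (xA + 2) - rA * xA) = 2 * xA + 3 - rA := by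
    simp [xA, rA]; ring
  have h3 : Polynomial.derivative ((xA + 1) ^ 2) = 2 * xA + 2 := by
    simp [xA, pow_two]; ring
  rw [h1, h2, h3]

theorem deriv_qxy : Polynomial.derivative qxy = Polynomial.monomial 1 (2 * (xA + 1))
    + Polynomial.monomial 0 ((xA + 1) * (xA + 2) - rA * xA) := by
  rw [qxy_eq]
  rw [Polynomial.derivative_add, Polynomial.derivative_add, Polynomial.derivative_monomial,
    Polynomial.derivative_monomial, Polynomial.derivative_monomial]
  norm_num [mul_comm]

theorem res22 {R : Type*} [CommRing R] (p q : Polynomial R) : res 2 2 p q =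
    (p.coeff 2 * q.coeff 0 - p.coeff 0 * q.coeff 2) ^ 2
    - (p.coeff 2 * q.coeff 1 - p.coeff 1 * q.coeff 2)
      * (p.coeff 1 * q.coeff 0 - p.coeff 0 * q.coeff 1) := by
  unfold res
  simp [Matrix.det_succ_row_zero, Fin.sum_univ_succ, Fin.succAbove]
  ring

theorem res12 {R : Type*} [CommRing R] (p q : Polynomial R) : res 1 2 p q =
    p.coeff 1 ^ 2 * q.coeff 0 - p.coeff 1 * p.coeff 0 * q.coeff 1
      + p.coeff 0 ^ 2 * q.coeff 2 := by
  unfold res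
  simp [Matrix.det_succ_row_zero, Fin.sum_univ_succ, Fin.succAbove]
  ring

theorem det7 {R : Type*} [CommRing R] (r d3 d2 d1 : R)
    (h3 : d3 = 2 * r - 2) (h2 : d2 = -1 + 6 * r - r ^ 2) (h1 : d1 = 4 * r) :
    Matrix.det !![r, r, -r^2, r^2, 0, 0, 0;
      0, r, r, -r^2, r^2, 0, 0;
      0, 0, r, r, -r^2, r^2, 0;
      0, 0, 0, r, r, -r^2, r^2;
      -1, d3, d2, d1, 0, 0, 0;
      0, -1, d3, d2, d1, 0, 0;
      0, 0, -1, d3, d2, d1, 0] = -(r ^ 8 * (r ^ 2 - 11 * r - 1) ^ 2) := by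
  simp [Matrix.det_succ_column_zero, Fin.sum_univ_succ, Fin.succAbove]
  subst h1 h2 h3
  ring

set_option maxHeartbeats 4000000 in
theorem stmt18 :
    ∃ S₁ S₂ : A,
      res 2 2 (pderivX qxy) qxy = (Polynomial.X + 1) * S₁ ∧
      res 1 2 (Polynomial.derivative qxy) qxy = (Polynomial.X + 1) * S₂ ∧
      res 3 4 S₁ S₂ =
        -(Polynomial.X ^ 8 * (Polynomial.X ^ 2 - 11 * Polynomial.X - 1) ^ 2) := by
  refine ⟨Polynomial.monomial 3 Polynomial.X + Polynomial.monomial 2 Polynomial.X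
      + Polynomial.monomial 1 (-Polynomial.X ^ 2) + Polynomial.monomial 0 (Polynomial.X ^ 2),
    Polynomial.monomial 4 (-1) + Polynomial.monomial 3 (2 * Polynomial.X - 2)
      + Polynomial.monomial 2 (-1 + 6 * Polynomial.X - Polynomial.X ^ 2)
      + Polynomial.monomial 1 (4 * Polynomial.X), ?_, ?_, ?_⟩
  · rw [res22, pderivX_qxy, qxy_eq]
    simp only [Polynomial.coeff_add, Polynomial.coeff_monomial]
    norm_num
    simp only [← Polynomial.C_mul_X_pow_eq_monomial, xA, rA]
    simp only [map_add, map_sub, map_mul, map_pow, map_one, map_ofNat, map_neg]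
    ring
  · rw [res12, deriv_qxy, qxy_eq]
    simp only [Polynomial.coeff_add, Polynomial.coeff_monomial]
    norm_num
    simp only [← Polynomial.C_mul_X_pow_eq_monomial, xA, rA]
    simp only [map_add, map_sub, map_mul, map_pow, map_one, map_ofNat, map_neg]
    ring
  · rw [← det7 (Polynomial.X : Polynomial ℝ) _ _ _ rfl rfl rfl]
    unfold res
    congr 1
    ext1 i j
    fin_cases i <;> fin_cases j <;> simp [Polynomial.coeff_monomial, -Polynomial.monomial_zero_left]
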